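/- arXiv:2510.15784 — 5 statements merged into one kernel-verified Lean document; each statement's English description precedes it below -/
import Mathlib

section
/- Let K be a positive integer and let B > 0 and A_{k'} > 0 for k' = 1,…,K. For a positive point x = (p^p, p^s_1,…,p^s_K), write S(x) = B·∑_{k'} p^s_{k'} + p^p·∑_{k'} A_{k'} p^s_{k'}, and for a positive expansion point y let M_y(x) = δ(y)·(p^p)^{ω^p(y)}·∏_{k'} (p^s_{k'})^{ω^s_{k'}(y)} denote the monomial approximation of Theorem 5 with exponents ω^p(y) = (q^p ∑_{k'} A_{k'} q^s_{k'})/S(y), ω^s_{k'}(y) = (B q^s_{k'} + q^p A_{k'} q^s_{k'})/S(y) and coefficient δ(y) = S(y)/((q^p)^{ω^p(y)} ∏_{k'} (q^s_{k'})^{ω^s_{k'}(y)}), where y = (q^p, q^s_1,…,q^s_K). Then for any two positive points x and y, M_x(x) = S(x) ≥ M_y(x); in particular, the monomial approximation recomputed at the current point always dominates the monomial approximation computed at any previous expansion point, evaluated at the current point. -/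
open Finset

/-- The bilinear-plus-linear function `S(x) = B·∑ pˢ + pᵖ·∑ A pˢ`. -/
noncomputable def Sfun (K : ℕ) (B : ℝ) (A : Fin K → ℝ) (pp : ℝ) (ps : Fin K → ℝ) : ℝ :=
  B * ∑ k, ps k + pp * ∑ k, A k * ps k

/-- Exponent `ωᵖ` of the monomial approximation computed at expansion point `(qp, qs)`. -/
noncomputable def omegaP (K : ℕ) (B : ℝ) (A : Fin K → ℝ) (qp : ℝ) (qs : Fin K → ℝ) : ℝ :=
  qp * (∑ k, A k * qs k) / Sfun K B A qp qs

/-- Exponents `ωˢ_{k'}` of the monomial approximation computed at `(qp, qs)`. -/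
noncomputable def omegaS (K : ℕ) (B : ℝ) (A : Fin K → ℝ) (qp : ℝ) (qs : Fin K → ℝ)
    (k : Fin K) : ℝ :=
  (B * qs k + qp * A k * qs k) / Sfun K B A qp qs

/-- Coefficient `δ` of the monomial approximation computed at `(qp, qs)`. -/
noncomputable def deltaCoef (K : ℕ) (B : ℝ) (A : Fin K → ℝ) (qp : ℝ) (qs : Fin K → ℝ) : ℝ :=
  Sfun K B A qp qs / (qp ^ omegaP K B A qp qs * ∏ k, qs k ^ omegaS K B A qp qs k)

/-- The monomial approximation `M_y(x)` of Theorem 5, with expansion point `y = (qp, qs)`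
evaluated at the point `x = (pp, ps)`. -/
noncomputable def monoApprox (K : ℕ) (B : ℝ) (A : Fin K → ℝ) (qp : ℝ) (qs : Fin K → ℝ)
    (pp : ℝ) (ps : Fin K → ℝ) : ℝ :=
  deltaCoef K B A qp qs * pp ^ omegaP K B A qp qs * ∏ k, ps k ^ omegaS K B A qp qs k

theorem Sfun_pos {K : ℕ} (hK : 0 < K) {B : ℝ} (hB : 0 < B) {A : Fin K → ℝ} (hA : ∀ k, 0 < A k)
    {q : ℝ} {s : Fin K → ℝ} (hq : 0 < q) (hs : ∀ k, 0 < s k) : 0 < Sfun K B A q s := by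
  have : Nonempty (Fin K) := ⟨⟨0, hK⟩⟩
  have h₁ : 0 < ∑ k, s k := sum_pos (fun k _ => hs k) univ_nonempty
  have h₂ : 0 < ∑ k, A k * s k := sum_pos (fun k _ => mul_pos (hA k) (hs k)) univ_nonempty
  unfold Sfun
  positivity

theorem monoApprox_self {K : ℕ} (B : ℝ) (A : Fin K → ℝ) {q : ℝ} {s : Fin K → ℝ}
    (hq : 0 < q) (hs : ∀ k, 0 < s k) : monoApprox K B A q s q s = Sfun K B A q s := by
  have h₁ : 0 < q ^ omegaP K B A q s := Real.rpow_pos_of_pos hq _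
  have h₂ : 0 < ∏ k, s k ^ omegaS K B A q s k :=
    prod_pos fun k _ => Real.rpow_pos_of_pos (hs k) _
  unfold monoApprox deltaCoef
  rw [mul_assoc, div_mul_cancel₀ _ (mul_pos h₁ h₂).ne']

theorem monoApprox_eq_mul_ratio {K : ℕ} (B : ℝ) (A : Fin K → ℝ) {p q : ℝ} {r s : Fin K → ℝ}
    (hp : 0 < p) (hr : ∀ k, 0 < r k) (hq : 0 < q) (hs : ∀ k, 0 < s k) :
    monoApprox K B A q s p r =
      Sfun K B A q s * ((p / q) ^ omegaP K B A q s * ∏ k, (r k / s k) ^ omegaS K B A q s k) := by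
  have h : ∏ k, (r k / s k) ^ omegaS K B A q s k =
      (∏ k, r k ^ omegaS K B A q s k) / ∏ k, s k ^ omegaS K B A q s k := by
    rw [← prod_div_distrib]
    exact prod_congr rfl fun k _ => Real.div_rpow (hr k).le (hs k).le _
  unfold monoApprox deltaCoef
  rw [h, Real.div_rpow hp.le hq.le]
  ring

/-- Weighted AM-GM applied to the `2K` monomials of `Sfun`. -/
theorem monoApprox_le_Sfun {K : ℕ} (hK : 0 < K) {B : ℝ} (hB : 0 < B) {A : Fin K → ℝ}
    (hA : ∀ k, 0 < A k) {p q : ℝ} {r s : Fin K → ℝ} (hp : 0 < p) (hr : ∀ k, 0 < r k)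
    (hq : 0 < q) (hs : ∀ k, 0 < s k) : monoApprox K B A q s p r ≤ Sfun K B A p r := by
  have hS : 0 < Sfun K B A q s := Sfun_pos hK hB hA hq hs
  rw [monoApprox_eq_mul_ratio B A hp hr hq hs]
  set S := Sfun K B A q s with hSdef
  have hu : 0 < p / q := div_pos hp hq
  have hv : ∀ k, 0 < r k / s k := fun k => div_pos (hr k) (hs k)
  let w : Fin K ⊕ Fin K → ℝ := Sum.elim (fun k => B * s k / S) (fun k => q * A k * s k / S)
  let z : Fin K ⊕ Fin K → ℝ := Sum.elim (fun k => r k / s k) (fun k => p / q * (r k / s k))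
  have hw : ∀ i ∈ univ, 0 ≤ w i := by
    rintro (k | k) -
    · exact (div_pos (mul_pos hB (hs k)) hS).le
    · exact (div_pos (mul_pos (mul_pos hq (hA k)) (hs k)) hS).le
  have hz : ∀ i ∈ univ, 0 ≤ z i := by
    rintro (k | k) -
    · exact (hv k).le
    · exact (mul_pos hu (hv k)).le
  have hω : omegaP K B A q s = ∑ k, q * A k * s k / S := by
    simp only [omegaP, ← hSdef, ← sum_div, mul_sum, mul_assoc]
  have hw_sum : ∑ i, w i = 1 := by
    simp only [w, Fintype.sum_sum_type, Sum.elim_inl, Sum.elim_inr, ← sum_div, ← add_div]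
    rw [div_eq_one_iff_eq hS.ne', hSdef]
    simp only [Sfun, mul_sum, mul_assoc]
  have hprod : ∏ i, z i ^ w i =
      (p / q) ^ omegaP K B A q s * ∏ k, (r k / s k) ^ omegaS K B A q s k := by
    simp only [w, z, Fintype.prod_sum_type, Sum.elim_inl, Sum.elim_inr]
    rw [hω, Real.rpow_sum_of_pos hu, ← prod_mul_distrib, ← prod_mul_distrib]
    refine prod_congr rfl fun k _ => ?_
    rw [omegaS, ← hSdef, add_div, Real.rpow_add (hv k), Real.mul_rpow hu.le (hv k).le]
    ring
  have hsum : S * ∑ i, w i * z i = Sfun K B A p r := by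
    simp only [w, z, Fintype.sum_sum_type, Sum.elim_inl, Sum.elim_inr, Sfun, mul_add, mul_sum]
    congr 1 <;> refine sum_congr rfl fun k _ => ?_
    all_goals
      have := (hs k).ne'
      field_simp
  rw [← hprod, ← hsum]
  exact mul_le_mul_of_nonneg_left
    (Real.geom_mean_le_arith_mean_weighted univ w z hw hw_sum hz) hS.le

/-- Feasibility-preservation step of the paper's convergence analysis:
`M_x(x) = S(x) ≥ M_y(x)` for any positive points `x = (pp, ps)` and `y = (qp, qs)`. -/
theorem stmt2 (K : ℕ) (hK : 0 < K) (B : ℝ) (hB : 0 < B) (A : Fin K → ℝ) (hA : ∀ k, 0 < A k)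
    (pp qp : ℝ) (ps qs : Fin K → ℝ) (hpp : 0 < pp) (hps : ∀ k, 0 < ps k)
    (hqp : 0 < qp) (hqs : ∀ k, 0 < qs k) :
    monoApprox K B A pp ps pp ps = Sfun K B A pp ps ∧
    Sfun K B A pp ps ≥ monoApprox K B A qp qs pp ps := by
  exact ⟨monoApprox_self B A hpp hps, monoApprox_le_Sfun hK hB hA hpp hps hqp hqs⟩
end

section
/- Let \hat x > 0 and define ζ = \hat x / (1 + \hat x) and ν = log₂(1 + \hat x) − ζ·log₂ \hat x. Then for every x > 0, log₂(1 + x) ≥ ζ·log₂ x + ν, with equality at x = \hat x. -/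
theorem mul_log_sub_log_le_log_one_add_sub {a x : ℝ} (ha : 0 < a) (hx : 0 < x) :
    a / (1 + a) * (Real.log x - Real.log a) ≤ Real.log (1 + x) - Real.log (1 + a) := by
  have h := strictConcaveOn_log_Ioi.concaveOn.2 (Set.mem_Ioi.2 one_pos)
    (Set.mem_Ioi.2 (div_pos hx ha))
    (show 0 ≤ 1 / (1 + a) by positivity) (show 0 ≤ a / (1 + a) by positivity) (by field_simp)
  have hmean : 1 / (1 + a) * 1 + a / (1 + a) * (x / a) = (1 + x) / (1 + a) := by field_simp
  simp only [smul_eq_mul] at h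
  rwa [hmean, Real.log_one, mul_zero, zero_add, Real.log_div hx.ne' ha.ne',
    Real.log_div (by positivity) (by positivity)] at h

/-- The logarithmic tangent-type lower bound (equation (25) of the paper):
`log₂(1+x) ≥ ζ·log₂ x + ν` for all `x > 0`, with equality at the expansion point. -/
theorem stmt4 (xhat : ℝ) (hxhat : 0 < xhat) (ζ ν : ℝ)
    (hζ : ζ = xhat / (1 + xhat))
    (hν : ν = Real.logb 2 (1 + xhat) - ζ * Real.logb 2 xhat) :
    (∀ x : ℝ, 0 < x → Real.logb 2 (1 + x) ≥ ζ * Real.logb 2 x + ν) ∧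
    Real.logb 2 (1 + xhat) = ζ * Real.logb 2 xhat + ν := by
  subst hζ hν
  refine ⟨fun x hx => ?_, by ring⟩
  have h := div_le_div_of_nonneg_right (mul_log_sub_log_le_log_one_add_sub hxhat hx)
    (Real.log_pos one_lt_two).le
  simp only [Real.logb, mul_div_assoc, sub_div] at h ⊢
  linarith
end

section
/- Let 0 < \hat x ≤ x, and define ζ = \hat x/(1+\hat x) and ν = log₂(1+\hat x) − ζ·log₂ \hat x. Then log₂(1 + x) ≥ ζ·log₂ x + ν ≥ ζ·log₂ \hat x + ν = log₂(1 + \hat x); in particular the true rate at the new point is at least the true rate at the previous point whenever the approximated (affine-in-log) objective does not decrease. -/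
/-- The tangent-type lower bound `ζ (log x - log y) ≤ log (1 + x) - log (1 + y)` with
`ζ = y / (1 + y)`, a consequence of the concavity of the logarithm. -/
theorem div_one_add_mul_log_sub_log_le {x y : ℝ} (hx : 0 < x) (hy : 0 < y) :
    y / (1 + y) * (Real.log x - Real.log y) ≤ Real.log (1 + x) - Real.log (1 + y) := by
  have hy1 : 0 < 1 + y := by positivity
  have hsum : 1 / (1 + y) + y / (1 + y) = 1 := by field_simp
  have h := strictConcaveOn_log_Ioi.concaveOn.2 (Set.mem_Ioi.2 one_pos)
    (Set.mem_Ioi.2 (div_pos hx hy)) (by positivity : 0 ≤ 1 / (1 + y))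
    (by positivity : 0 ≤ y / (1 + y)) hsum
  have hmean : 1 / (1 + y) * 1 + y / (1 + y) * (x / y) = (1 + x) / (1 + y) := by
    field_simp
  simp only [smul_eq_mul] at h
  rw [hmean, Real.log_one, mul_zero, zero_add, Real.log_div hx.ne' hy.ne',
    Real.log_div (by positivity) hy1.ne'] at h
  exact h

/-- Monotonicity step of the paper's convergence proof: with `ζ, ν` computed at the
previous iterate `x̂`, the surrogate objective `ζ·log₂ x + ν` is sandwiched between
`log₂(1+x)` and `log₂(1+x̂)` whenever `0 < x̂ ≤ x`. -/
theorem stmt5 (xhat x : ℝ) (hxhat : 0 < xhat) (hx : xhat ≤ x) (ζ ν : ℝ)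
    (hζ : ζ = xhat / (1 + xhat))
    (hν : ν = Real.logb 2 (1 + xhat) - ζ * Real.logb 2 xhat) :
    Real.logb 2 (1 + x) ≥ ζ * Real.logb 2 x + ν ∧
    ζ * Real.logb 2 x + ν ≥ ζ * Real.logb 2 xhat + ν ∧
    ζ * Real.logb 2 xhat + ν = Real.logb 2 (1 + xhat) := by
  have hζ0 : 0 ≤ ζ := by rw [hζ]; positivity
  refine ⟨?_, ?_, by rw [hν]; ring⟩
  · have h := div_one_add_mul_log_sub_log_le (hxhat.trans_le hx) hxhat
    rw [← hζ] at h
    have h2 := div_le_div_of_nonneg_right h (Real.log_nonneg one_le_two)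
    rw [hν]
    simp only [Real.logb]
    ring_nf at h2 ⊢
    linarith
  · have h := Real.logb_le_logb_of_le one_lt_two hxhat hx
    have := mul_le_mul_of_nonneg_left h hζ0
    linarith
end

section
/- Fix a positive integer M, a positive integer K, positive constants β_1,…,β_K, q^d_1,…,q^d_K, q^p > 0, τ > 0, ρ > 0, Φ̄ > 0 (playing the role of |Φ|²), σ² > 0, ρ_RF > 0 and σ_RF² > 0, and an index k ∈ {1,…,K}. For t > 0 define the scaled MRC uplink SINRs S_RAQR(t) = [M·(t q^d_k)·ρ τ (t q^p)·β_k²·Φ̄] / [ (∑_{k'=1}^K t q^d_{k'} β_{k'} + σ²/(Φ̄ ρ)) · (ρ τ t q^p β_k Φ̄ + σ²) ] and S_RF(t) = [M·(t q^d_k)·ρ_RF τ (t q^p)·β_k²] / [ (∑_{k'=1}^K t q^d_{k'} β_{k'} + σ_RF²/ρ_RF) · (ρ_RF τ t q^p β_k + σ_RF²) ]. Then lim_{t → 0⁺} S_RAQR(t) / S_RF(t) = (ρ² Φ̄² / σ⁴) · (σ_RF⁴ / ρ_RF²). -/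
open Finset Filter

/-- Corollary 1 of the paper for MRC detection (the "squaring effect"): as all uplink
pilot and payload powers are scaled by `t → 0⁺`, the ratio of the RAQR MRC uplink SINR
lower bound to the conventional RF-MIMO one converges to `(ρ²Φ̄²/σ⁴)·(σ_RF⁴/ρ_RF²)`. -/
theorem stmt6 (M K : ℕ) (hM : 0 < M) (hK : 0 < K)
    (β qd : Fin K → ℝ) (hβ : ∀ j, 0 < β j) (hqd : ∀ j, 0 < qd j)
    (qp τ ρ Φ σ2 ρRF σRF2 : ℝ)
    (hqp : 0 < qp) (hτ : 0 < τ) (hρ : 0 < ρ) (hΦ : 0 < Φ) (hσ2 : 0 < σ2)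
    (hρRF : 0 < ρRF) (hσRF2 : 0 < σRF2) (k : Fin K) :
    Tendsto (fun t : ℝ =>
      (((M : ℝ) * (t * qd k) * (ρ * τ * (t * qp)) * (β k) ^ 2 * Φ) /
        ((∑ k', t * qd k' * β k' + σ2 / (Φ * ρ)) * (ρ * τ * (t * qp) * β k * Φ + σ2))) /
      (((M : ℝ) * (t * qd k) * (ρRF * τ * (t * qp)) * (β k) ^ 2) /
        ((∑ k', t * qd k' * β k' + σRF2 / ρRF) * (ρRF * τ * (t * qp) * β k + σRF2))))
      (nhdsWithin 0 (Set.Ioi 0))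
      (nhds ((ρ ^ 2 * Φ ^ 2 / σ2 ^ 2) * (σRF2 ^ 2 / ρRF ^ 2))) := by
  have hcont : ContinuousAt (fun t : ℝ => ρ * Φ / ρRF *
      (((∑ k', t * qd k' * β k' + σRF2 / ρRF) * (ρRF * τ * (t * qp) * β k + σRF2)) /
        ((∑ k', t * qd k' * β k' + σ2 / (Φ * ρ)) *
          (ρ * τ * (t * qp) * β k * Φ + σ2)))) 0 := by
    refine continuousAt_const.mul (ContinuousAt.div (by fun_prop) (by fun_prop) ?_)
    simp only [zero_mul, mul_zero, sum_const_zero, zero_add]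
    positivity
  have hlim := hcont.tendsto.mono_left (nhdsWithin_le_nhds (s := Set.Ioi 0))
  have hvalue : ρ * Φ / ρRF * ((σRF2 / ρRF * σRF2) / (σ2 / (Φ * ρ) * σ2)) =
      (ρ ^ 2 * Φ ^ 2 / σ2 ^ 2) * (σRF2 ^ 2 / ρRF ^ 2) := by
    field_simp
  simp only [zero_mul, mul_zero, sum_const_zero, zero_add, hvalue] at hlim
  refine hlim.congr' ?_
  filter_upwards [self_mem_nhdsWithin] with t ht
  have ht : 0 < t := ht
  have hβk := hβ k
  have hqdk := hqd k
  have hsum : 0 ≤ ∑ k', t * qd k' * β k' :=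
    sum_nonneg fun j _ => (mul_pos (mul_pos ht (hqd j)) (hβ j)).le
  generalize ∑ k', t * qd k' * β k' = S at hsum
  have hS : S + σ2 / (Φ * ρ) ≠ 0 := by positivity
  have hSRF : S + σRF2 / ρRF ≠ 0 := by positivity
  have hN : ρ * τ * (t * qp) * β k * Φ + σ2 ≠ 0 := by positivity
  have hNRF : ρRF * τ * (t * qp) * β k + σRF2 ≠ 0 := by positivity
  generalize S + σ2 / (Φ * ρ) = a at hS
  generalize S + σRF2 / ρRF = b at hSRF
  generalize ρ * τ * (t * qp) * β k * Φ + σ2 = c at hN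
  generalize ρRF * τ * (t * qp) * β k + σRF2 = d at hNRF
  field_simp
end

section
/- Fix positive integers M and K with M > K, positive constants β_1,…,β_K, q^d_1,…,q^d_K, q^p_1,…,q^p_K, τ > 0, ρ > 0, Φ̄ > 0 (playing the role of |Φ|²), σ² > 0, ρ_RF > 0 and σ_RF² > 0, and an index k ∈ {1,…,K}. For t > 0 define e_{k'}(t) = β_{k'} σ² / (ρ τ t q^p_{k'} β_{k'} Φ̄ + σ²) and the scaled ZF uplink SINR S_RAQR(t) = [(M−K)·(t q^d_k)·ρ τ (t q^p_k)·β_k²·Φ̄] / [ (∑_{k'=1}^K t q^d_{k'} e_{k'}(t) + σ²/(Φ̄ ρ)) · (ρ τ t q^p_k β_k Φ̄ + σ²) ], and define S_RF(t) analogously with Φ̄ replaced by 1, ρ by ρ_RF and σ² by σ_RF² (also inside e_{k'}). Then lim_{t → 0⁺} S_RAQR(t) / S_RF(t) = (ρ² Φ̄² / σ⁴) · (σ_RF⁴ / ρ_RF²). -/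
open Finset Filter

/-- As `t → 0`, the denominator of the scaled SINR tends to `σ2 / (Φ * ρ) * σ2`. -/
theorem tendsto_zf_sinr_denom {ι : Type*} [Fintype ι] (β qd qp : ι → ℝ) {τ ρ Φ σ2 : ℝ}
    (hσ2 : σ2 ≠ 0) (k : ι) :
    Tendsto (fun t : ℝ =>
      (∑ k', t * qd k' * (β k' * σ2 / (ρ * τ * (t * qp k') * β k' * Φ + σ2)) +
        σ2 / (Φ * ρ)) * (ρ * τ * (t * qp k) * β k * Φ + σ2))
      (nhds 0) (nhds (σ2 / (Φ * ρ) * σ2)) := by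
  have hcont : ContinuousAt (fun t : ℝ =>
      (∑ k', t * qd k' * (β k' * σ2 / (ρ * τ * (t * qp k') * β k' * Φ + σ2)) +
        σ2 / (Φ * ρ)) * (ρ * τ * (t * qp k) * β k * Φ + σ2)) 0 := by
    refine ContinuousAt.mul (ContinuousAt.add (tendsto_finsetSum _ fun j _ => ?_)
      continuousAt_const) (by fun_prop)
    refine Tendsto.mul (f := fun t : ℝ => t * qd j) (Continuous.tendsto (by fun_prop) 0) ?_
    exact ContinuousAt.div (by fun_prop) (by fun_prop) (by simpa using hσ2)
  simpa [ContinuousAt] using hcont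

/-- Corollary 1 of the paper for ZF detection (the "squaring effect"): as all uplink
pilot and payload powers are scaled by `t → 0⁺`, the ratio of the RAQR ZF uplink SINR
lower bound (with estimation-error terms `e_{k'}(t)`) to the conventional RF-MIMO one
converges to `(ρ²Φ̄²/σ⁴)·(σ_RF⁴/ρ_RF²)`. -/
theorem stmt7 (M K : ℕ) (hK : 0 < K) (hMK : K < M)
    (β qd qp : Fin K → ℝ) (hβ : ∀ j, 0 < β j) (hqd : ∀ j, 0 < qd j) (hqp : ∀ j, 0 < qp j)
    (τ ρ Φ σ2 ρRF σRF2 : ℝ)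
    (hτ : 0 < τ) (hρ : 0 < ρ) (hΦ : 0 < Φ) (hσ2 : 0 < σ2)
    (hρRF : 0 < ρRF) (hσRF2 : 0 < σRF2) (k : Fin K) :
    Tendsto (fun t : ℝ =>
      ((((M : ℝ) - (K : ℝ)) * (t * qd k) * (ρ * τ * (t * qp k)) * (β k) ^ 2 * Φ) /
        ((∑ k', t * qd k' * (β k' * σ2 / (ρ * τ * (t * qp k') * β k' * Φ + σ2)) +
            σ2 / (Φ * ρ)) * (ρ * τ * (t * qp k) * β k * Φ + σ2))) /
      ((((M : ℝ) - (K : ℝ)) * (t * qd k) * (ρRF * τ * (t * qp k)) * (β k) ^ 2) /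
        ((∑ k', t * qd k' * (β k' * σRF2 / (ρRF * τ * (t * qp k') * β k' + σRF2)) +
            σRF2 / ρRF) * (ρRF * τ * (t * qp k) * β k + σRF2))))
      (nhdsWithin 0 (Set.Ioi 0))
      (nhds ((ρ ^ 2 * Φ ^ 2 / σ2 ^ 2) * (σRF2 ^ 2 / ρRF ^ 2))) := by
  have hD := (tendsto_zf_sinr_denom β qd qp (τ := τ) (ρ := ρ) (Φ := Φ) hσ2.ne' k).mono_left
    (nhdsWithin_le_nhds (s := Set.Ioi 0))
  have hDRF := (tendsto_zf_sinr_denom β qd qp (τ := τ) (ρ := ρRF) (Φ := 1) hσRF2.ne' k).mono_left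
    (nhdsWithin_le_nhds (s := Set.Ioi 0))
  simp only [mul_one, one_mul] at hDRF
  have hlim := (hDRF.div hD (by positivity)).const_mul (ρ * Φ / ρRF)
  have hval : ρ * Φ / ρRF * (σRF2 / ρRF * σRF2 / (σ2 / (Φ * ρ) * σ2)) =
      (ρ ^ 2 * Φ ^ 2 / σ2 ^ 2) * (σRF2 ^ 2 / ρRF ^ 2) := by
    field_simp
  rw [hval] at hlim
  refine hlim.congr' ?_
  filter_upwards [self_mem_nhdsWithin] with t (ht : 0 < t)
  have hMK' : (M : ℝ) - K ≠ 0 := sub_ne_zero.2 (by exact_mod_cast hMK.ne')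
  have hβk := (hβ k).ne'
  have hqdk := (hqd k).ne'
  have hqpk := (hqp k).ne'
  rw [div_div_div_eq, mul_comm (_ * _) (_ * β k ^ 2), mul_div_mul_comm]
  congr 1
  field_simp
end
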